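/- Let n ≥ 2 and let f : ℝ^n → ℝ be twice continuously differentiable. Let u : ℝ^n → (0, ∞) be continuously differentiable with |∇u(x)| ≤ 1 for all x ∈ ℝ^n (so the graph S = {(x, u(x)) : x ∈ ℝ^n} is a space like hypersurface in ℝ^n × ℝ⁺). Suppose that the spherical mean transform Rf vanishes together with all of its n + 1 first-order partial derivatives at every point of S, i.e. Rf(x, u(x)) = 0 and ∂_{x_i}(Rf)(x, u(x)) = 0 for i = 1, …, n and ∂_t(Rf)(x, u(x)) = 0 for all x ∈ ℝ^n. Then Rf(p, T) = 0 for every p ∈ ℝ^n and every T ≥ u(p) (i.e. at every point above S). -/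

import Mathlib

open MeasureTheory

/-- The spherical mean transform of `f : ℝⁿ → ℝ`, as a function on `ℝⁿ × ℝ`:
`Rf(x, t) = ∫_{{y : |y − x| = t}} f dH^{n−1}`. -/
noncomputable def sphericalMean (n : ℕ) (f : EuclideanSpace ℝ (Fin n) → ℝ)
    (p : EuclideanSpace ℝ (Fin n) × ℝ) : ℝ :=
  ∫ y in Metric.sphere p.1 p.2, f y ∂(μH[(n : ℝ) - 1])

theorem hausdorffMeasure_unitSphere_lt_top (n : ℕ) (hn : 1 ≤ n) :
    μH[(n : ℝ) - 1] (Metric.sphere (0 : EuclideanSpace ℝ (Fin n)) 1) < ⊤ := by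
  obtain ⟨m, rfl⟩ := Nat.exists_eq_add_of_le' hn
  let Q : Fin (m + 1) → ℝ → (Fin m → ℝ) → EuclideanSpace ℝ (Fin (m + 1)) :=
    fun i c w => WithLp.toLp 2 (i.insertNth c w)
  let P : Fin (m + 1) → ℝ → (Fin m → ℝ) → EuclideanSpace ℝ (Fin (m + 1)) :=
    fun i c w => ‖Q i c w‖⁻¹ • Q i c w
  have hQ0 : ∀ i c w, c ≠ 0 → Q i c w ≠ 0 := by
    intro i c w hc h
    have : (Q i c w) i = 0 := by rw [h]; rfl
    exact hc (by simpa [Q] using this)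
  have hQ : ∀ i c, ContDiff ℝ 1 (Q i c) := by
    intro i c
    rw [contDiff_piLp]
    intro j
    refine Fin.succAboveCases i ?_ ?_ j
    · simpa [Q] using contDiff_const
    · intro k
      simpa [Q] using contDiff_apply ℝ ℝ k
  have hP : ∀ i c, c ≠ 0 → ContDiff ℝ 1 (P i c) := by
    intro i c hc
    exact (((hQ i c).norm ℝ (fun w => hQ0 i c w hc)).inv
      (fun w => norm_ne_zero_iff.2 (hQ0 i c w hc))).smul (hQ i c)
  have hfin : ∀ i c, c ≠ 0 → μH[(m : ℝ)] (P i c '' Set.Icc (-1) 1) < ⊤ := by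
    intro i c hc
    obtain ⟨K, hK⟩ := (hP i c hc).contDiffOn.exists_lipschitzOnWith (by simp)
      (convex_Icc (-1 : Fin m → ℝ) 1) isCompact_Icc
    refine (hK.hausdorffMeasure_image_le (Nat.cast_nonneg m)).trans_lt ?_
    refine ENNReal.mul_lt_top (by simp) ?_
    have := hausdorffMeasure_pi_real (ι := Fin m)
    rw [Fintype.card_fin] at this
    rw [this]
    exact isCompact_Icc.measure_lt_top
  have hcov : Metric.sphere (0 : EuclideanSpace ℝ (Fin (m + 1))) 1 ⊆
      ⋃ i, (P i 1 '' Set.Icc (-1) 1 ∪ P i (-1) '' Set.Icc (-1) 1) := by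
    intro x hx
    have hx1 : ‖x‖ = 1 := by simpa using hx
    obtain ⟨i, -, hi⟩ := Finset.exists_max_image Finset.univ (fun j => |x j|) ⟨0, by simp⟩
    have hxi : x i ≠ 0 := by
      intro h0
      have : x = 0 := by
        ext j
        have := hi j (by simp)
        simpa [h0] using this
      simp [this] at hx1
    have hpos : 0 < |x i| := abs_pos.2 hxi
    have hins : ∀ c, c * |x i| = x i →
        Q i c (fun k => |x i|⁻¹ * x (i.succAbove k)) = |x i|⁻¹ • x := by
      intro c hc
      ext j
      refine Fin.succAboveCases i ?_ ?_ j
      · simp only [Q, Fin.insertNth_apply_same, PiLp.smul_apply, smul_eq_mul]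
        field_simp; exact hc
      · intro k
        simp [Q]
    have hPx : ∀ c, c * |x i| = x i → P i c (fun k => |x i|⁻¹ * x (i.succAbove k)) = x := by
      intro c hc
      simp only [P]
      rw [hins c hc, norm_smul, hx1]
      simp [smul_smul, hpos.ne']
    have hbox : (fun k => |x i|⁻¹ * x (i.succAbove k)) ∈ Set.Icc (-1 : Fin m → ℝ) 1 := by
      have : ∀ k, |(|x i|⁻¹ * x (i.succAbove k))| ≤ 1 := by
        intro k
        rw [abs_mul, abs_inv, abs_abs, inv_mul_le_iff₀ hpos, mul_one]
        exact hi _ (by simp)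
      exact ⟨fun k => (abs_le.1 (this k)).1, fun k => (abs_le.1 (this k)).2⟩
    refine Set.mem_iUnion.2 ⟨i, ?_⟩
    rcases abs_choice (x i) with h | h
    · exact Or.inl ⟨_, hbox, hPx 1 (by rw [h, one_mul])⟩
    · exact Or.inr ⟨_, hbox, hPx (-1) (by rw [h]; ring)⟩
  have hd : ((m + 1 : ℕ) : ℝ) - 1 = m := by push_cast; ring
  rw [hd]
  refine (measure_mono hcov).trans_lt ((measure_iUnion_le _).trans_lt ?_)
  rw [tsum_fintype]
  exact ENNReal.sum_lt_top.2 fun i _ => (measure_union_le _ _).trans_lt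
    (ENNReal.add_lt_top.2 ⟨hfin i 1 one_ne_zero, hfin i (-1) (by norm_num)⟩)

section ParametricIntegral

variable {H Y G : Type*} [NormedAddCommGroup H] [NormedSpace ℝ H] [FiniteDimensional ℝ H]
  [NormedAddCommGroup Y] [NormedSpace ℝ Y] [FiniteDimensional ℝ Y] [MeasurableSpace Y]
  [BorelSpace Y] [NormedAddCommGroup G] [NormedSpace ℝ G]
  {μ : Measure Y} [IsFiniteMeasure μ] {K : Set Y}

theorem continuous_integral_of_ae_mem_compact (hK : IsCompact K) (hμ : ∀ᵐ y ∂μ, y ∈ K)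
    {F : H × Y → G} (hF : Continuous F) : Continuous fun z => ∫ y, F (z, y) ∂μ := by
  have := FiniteDimensional.proper ℝ H
  have h := continuous_parametric_integral_of_continuous (μ := μ) (X := H)
    (f := fun z y => F (z, y)) hF hK
  rwa [Measure.restrict_eq_self_of_ae_mem hμ] at h

theorem integrable_of_ae_mem_compact {G : Type*} [NormedAddCommGroup G] (hK : IsCompact K)
    (hμ : ∀ᵐ y ∂μ, y ∈ K) {F : Y → G} (hF : Continuous F) : Integrable F μ := by
  rw [← Measure.restrict_eq_self_of_ae_mem hμ]
  exact hF.continuousOn.integrableOn_compact hK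

theorem hasFDerivAt_integral_of_ae_mem_compact (hK : IsCompact K) (hμ : ∀ᵐ y ∂μ, y ∈ K)
    {F : H × Y → G} (hF : ContDiff ℝ 1 F) (z : H) :
    HasFDerivAt (fun z => ∫ y, F (z, y) ∂μ)
      (∫ y, (fderiv ℝ F (z, y)).comp (ContinuousLinearMap.inl ℝ H Y) ∂μ) z := by
  have := FiniteDimensional.proper ℝ H
  have hF' : Continuous fun q : H × Y => (fderiv ℝ F q).comp (ContinuousLinearMap.inl ℝ H Y) :=
    (hF.continuous_fderiv one_ne_zero).clm_comp continuous_const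
  obtain ⟨C, hC⟩ := ((isCompact_closedBall z 1).prod hK).exists_bound_of_continuousOn
    hF'.continuousOn
  refine hasFDerivAt_integral_of_dominated_of_fderiv_le
    (F' := fun z y => (fderiv ℝ F (z, y)).comp (ContinuousLinearMap.inl ℝ H Y))
    (bound := fun _ => C) (Metric.closedBall_mem_nhds z one_pos) ?_ ?_ ?_ ?_ ?_ ?_
  · exact .of_forall fun z => (hF.continuous.comp (by fun_prop)).aestronglyMeasurable
  · exact integrable_of_ae_mem_compact hK hμ (hF.continuous.comp (by fun_prop))
  · exact (hF'.comp (by fun_prop : Continuous fun y : Y => (z, y))).aestronglyMeasurable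
  · filter_upwards [hμ] with y hy w hw using hC (w, y) ⟨hw, hy⟩
  · exact integrable_const C
  · refine .of_forall fun y w _ => ?_
    exact (hF.differentiable one_ne_zero (w, y)).hasFDerivAt.comp w
      (hasFDerivAt_prodMk_left w y)

theorem contDiff_one_integral_of_ae_mem_compact (hK : IsCompact K) (hμ : ∀ᵐ y ∂μ, y ∈ K)
    {F : H × Y → G} (hF : ContDiff ℝ 1 F) : ContDiff ℝ 1 fun z => ∫ y, F (z, y) ∂μ := by
  rw [contDiff_one_iff_hasFDerivAt]
  refine ⟨_, ?_, hasFDerivAt_integral_of_ae_mem_compact hK hμ hF⟩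
  exact continuous_integral_of_ae_mem_compact hK hμ
    (F := fun q => (fderiv ℝ F q).comp (ContinuousLinearMap.inl ℝ H Y))
    ((hF.continuous_fderiv one_ne_zero).clm_comp continuous_const)

theorem contDiff_two_integral_of_ae_mem_compact (hK : IsCompact K) (hμ : ∀ᵐ y ∂μ, y ∈ K)
    {F : H × Y → G} (hF : ContDiff ℝ 2 F) : ContDiff ℝ 2 fun z => ∫ y, F (z, y) ∂μ := by
  rw [show (2 : WithTop ℕ∞) = ((1 : ℕ) : WithTop ℕ∞) + 1 by norm_num,
    contDiff_succ_iff_hasFDerivAt]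
  refine ⟨_, ?_, hasFDerivAt_integral_of_ae_mem_compact hK hμ (hF.of_le (by norm_num))⟩
  exact contDiff_one_integral_of_ae_mem_compact hK hμ
    (F := fun q => (fderiv ℝ F q).comp (ContinuousLinearMap.inl ℝ H Y))
    ((hF.fderiv_right (by norm_num)).clm_comp contDiff_const)

end ParametricIntegral

section RotationInvariant

variable {n : ℕ} {σ : Measure (EuclideanSpace ℝ (Fin n))} [IsFiniteMeasure σ]

local notation "𝔼" n => EuclideanSpace ℝ (Fin n)

theorem integral_fderiv_skewAdjoint_eq_zero (hσ : ∀ᵐ ω ∂σ, ω ∈ Metric.sphere (0 : 𝔼 n) 1)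
    (hrot : ∀ U : (𝔼 n) ≃ₗᵢ[ℝ] (𝔼 n), MeasurePreserving U σ σ)
    {g : (𝔼 n) → ℝ} (hg : ContDiff ℝ 1 g) {A : (𝔼 n) →L[ℝ] (𝔼 n)}
    (hA : A ∈ skewAdjoint ((𝔼 n) →L[ℝ] (𝔼 n))) :
    ∫ ω, fderiv ℝ g ω (A ω) ∂σ = 0 := by
  let F : ℝ × (𝔼 n) → ℝ := fun q => g (NormedSpace.exp (q.1 • A) q.2)
  have hexp : ∀ θ : ℝ, HasDerivAt (fun θ : ℝ => NormedSpace.exp (θ • A))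
      (NormedSpace.exp (θ • A) * A) θ := fun θ => hasDerivAt_exp_smul_const A θ
  have hexpC : ContDiff ℝ 1 fun θ : ℝ => NormedSpace.exp (θ • A) := by
    rw [contDiff_one_iff_deriv]
    refine ⟨fun θ => (hexp θ).differentiableAt, ?_⟩
    rw [funext fun θ => (hexp θ).deriv]
    exact (continuous_iff_continuousAt.2 fun θ => (hexp θ).continuousAt).mul continuous_const
  have hF : ContDiff ℝ 1 F := hg.comp ((hexpC.comp contDiff_fst).clm_apply contDiff_snd)
  have hexp0 : NormedSpace.exp ((0 : ℝ) • A) = 1 := by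
    rw [show (0 : ℝ) • A = 0 from zero_smul ℝ A, NormedSpace.exp_zero]
  have hconst : ∀ θ, ∫ ω, F (θ, ω) ∂σ = ∫ ω, g ω ∂σ := by
    intro θ
    let : NormedAlgebra ℚ ((𝔼 n) →L[ℝ] (𝔼 n)) := NormedAlgebra.restrictScalars ℚ ℝ _
    have hU : NormedSpace.exp (θ • A) ∈ unitary ((𝔼 n) →L[ℝ] (𝔼 n)) :=
      NormedSpace.exp_mem_unitary_of_mem_skewAdjoint (skewAdjoint.smul_mem θ hA)
    let U := Unitary.linearIsometryEquiv (𝕜 := ℝ) ⟨_, hU⟩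
    exact (hrot U).integral_comp U.toHomeomorph.measurableEmbedding g
  have hd := hasFDerivAt_integral_of_ae_mem_compact (isCompact_sphere _ _) hσ hF 0
  rw [funext hconst] at hd
  have h0 := hd.unique (hasFDerivAt_const _ _)
  have h1 := congrArg (fun L : ℝ →L[ℝ] ℝ => L 1) h0
  rw [ContinuousLinearMap.integral_apply] at h1
  · rw [_root_.zero_apply] at h1
    rw [← h1]
    refine integral_congr_ae (.of_forall fun ω => ?_)
    have e1 : HasFDerivAt F (fderiv ℝ F (0, ω)) (0, ω) :=
      (hF.differentiable one_ne_zero _).hasFDerivAt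
    have e0 : HasDerivAt (fun θ : ℝ => (θ, ω)) (1, 0) 0 :=
      (hasDerivAt_id (0 : ℝ)).prodMk (hasDerivAt_const _ ω)
    have e2 : HasDerivAt (fun θ : ℝ => F (θ, ω)) (fderiv ℝ F (0, ω) (1, 0)) 0 :=
      HasFDerivAt.comp_hasDerivAt (l := F) (0 : ℝ) e1 e0
    have e3 : HasDerivAt (fun θ : ℝ => NormedSpace.exp (θ • A) ω) (A ω) 0 := by
      have := (hexp 0).clm_apply (hasDerivAt_const (0 : ℝ) ω)
      simpa [hexp0] using this
    have e4 : HasDerivAt (fun θ : ℝ => F (θ, ω)) (fderiv ℝ g ω (A ω)) 0 := by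
      have hg' : HasFDerivAt g (fderiv ℝ g ω) (NormedSpace.exp ((0 : ℝ) • A) ω) := by
        simpa [hexp0] using (hg.differentiable one_ne_zero ω).hasFDerivAt
      exact hg'.comp_hasDerivAt (0 : ℝ) e3
    simpa using e4.unique e2
  · exact integrable_of_ae_mem_compact (isCompact_sphere _ _) hσ
      (((hF.continuous_fderiv one_ne_zero).comp (by fun_prop)).clm_comp continuous_const)

theorem integral_laplacian_sub_radial_eq_zero (hσ : ∀ᵐ ω ∂σ, ω ∈ Metric.sphere (0 : 𝔼 n) 1)
    (hrot : ∀ U : (𝔼 n) ≃ₗᵢ[ℝ] (𝔼 n), MeasurePreserving U σ σ)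
    {h : (𝔼 n) → ℝ} (hh : ContDiff ℝ 2 h) :
    ∫ ω, ((∑ i, fderiv ℝ (fderiv ℝ h) ω (EuclideanSpace.single i 1) (EuclideanSpace.single i 1))
      - fderiv ℝ (fderiv ℝ h) ω ω ω - ((n : ℝ) - 1) * fderiv ℝ h ω ω) ∂σ = 0 := by
  let e : Fin n → (𝔼 n) := fun i => EuclideanSpace.single i 1
  let A : Fin n → Fin n → (𝔼 n) →L[ℝ] (𝔼 n) := fun i j =>
    (EuclideanSpace.proj j : (𝔼 n) →L[ℝ] ℝ).smulRight (e i)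
      - (EuclideanSpace.proj i : (𝔼 n) →L[ℝ] ℝ).smulRight (e j)
  have hAa : ∀ i j ω, A i j ω = ω j • e i - ω i • e j := fun i j ω => rfl
  have hA : ∀ i j, A i j ∈ skewAdjoint ((𝔼 n) →L[ℝ] (𝔼 n)) := by
    intro i j
    rw [skewAdjoint.mem_iff, ContinuousLinearMap.star_eq_adjoint, eq_comm,
      ContinuousLinearMap.eq_adjoint_iff]
    intro x y
    simp only [_root_.neg_apply, hAa, inner_neg_left, inner_sub_left,
      inner_sub_right, inner_smul_left, inner_smul_right, e, EuclideanSpace.inner_single_left,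
      EuclideanSpace.inner_single_right]
    simp
    ring
  have hD : ContDiff ℝ 1 (fderiv ℝ h) := hh.fderiv_right (by norm_num)
  have hD' : ∀ ω, HasFDerivAt (fderiv ℝ h) (fderiv ℝ (fderiv ℝ h) ω) ω := fun ω =>
    (hD.differentiable one_ne_zero ω).hasFDerivAt
  let g : Fin n → Fin n → (𝔼 n) → ℝ := fun i j ω => fderiv ℝ h ω (e i) * ω j
  have hg : ∀ i j, ContDiff ℝ 1 (g i j) := fun i j =>
    (hD.clm_apply contDiff_const).mul (by fun_prop)
  have hg' : ∀ i j ω w, fderiv ℝ (g i j) ω w =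
      fderiv ℝ (fderiv ℝ h) ω w (e i) * ω j + fderiv ℝ h ω (e i) * w j := by
    intro i j ω w
    have h1 : HasFDerivAt (fun ω : 𝔼 n => ω j) (EuclideanSpace.proj j : (𝔼 n) →L[ℝ] ℝ) ω :=
      (EuclideanSpace.proj j : (𝔼 n) →L[ℝ] ℝ).hasFDerivAt
    have h2 := ((hD' ω).clm_apply (hasFDerivAt_const (e i) ω)).mul h1
    rw [show fderiv ℝ (g i j) ω = _ from h2.fderiv]
    simp
    ring
  have hsum : ∫ ω, ∑ i, ∑ j, fderiv ℝ (g i j) ω (A i j ω) ∂σ = 0 := by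
    have h_int : ∀ i j, Integrable (fun ω => fderiv ℝ (g i j) ω (A i j ω)) σ := fun i j =>
      integrable_of_ae_mem_compact (isCompact_sphere _ _) hσ
        (((hg i j).continuous_fderiv one_ne_zero).clm_apply (A i j).continuous)
    rw [integral_finsetSum _ fun i _ => integrable_finsetSum _ fun j _ => h_int i j]
    refine Finset.sum_eq_zero fun i _ => ?_
    rw [integral_finsetSum _ fun j _ => h_int i j]
    exact Finset.sum_eq_zero fun j _ =>
      integral_fderiv_skewAdjoint_eq_zero hσ hrot (hg i j) (hA i j)
  rw [← hsum]
  refine integral_congr_ae ?_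
  filter_upwards [hσ] with ω hω
  have hω1 : ∑ j, ω j ^ 2 = 1 := by
    have : ‖ω‖ = 1 := by simpa using hω
    rw [← EuclideanSpace.real_norm_sq_eq, this, one_pow]
  have hωe : ω = ∑ j, ω j • e j := by
    ext k
    simp [e, Pi.single_apply]
  have hL : ∀ L : (𝔼 n) →L[ℝ] ℝ, L ω = ∑ j, ω j * L (e j) := by
    intro L
    conv_lhs => rw [hωe]
    simp
  have hsingle : ∀ i j, (e i) j = if j = i then 1 else 0 := fun i j => by simp [e]
  have key : ∀ i, ∑ j, fderiv ℝ (g i j) ω (A i j ω) =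
      fderiv ℝ (fderiv ℝ h) ω (e i) (e i) - ω i * fderiv ℝ (fderiv ℝ h) ω ω (e i)
        + (1 - n) * (ω i * fderiv ℝ h ω (e i)) := by
    intro i
    have hj : ∀ j, fderiv ℝ (g i j) ω (A i j ω) =
        fderiv ℝ (fderiv ℝ h) ω (e i) (e i) * ω j ^ 2
        - ω i * (ω j * fderiv ℝ (fderiv ℝ h) ω (e j) (e i))
        + fderiv ℝ h ω (e i) * ((if j = i then ω j else 0) - ω i) := by
      intro j
      rw [hg', hAa]
      simp only [map_sub, map_smul, _root_.sub_apply, _root_.smul_apply,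
        smul_eq_mul, PiLp.sub_apply, PiLp.smul_apply, hsingle]
      split_ifs <;> simp <;> ring
    have h2 := hL ((ContinuousLinearMap.apply ℝ ℝ (e i)).comp (fderiv ℝ (fderiv ℝ h) ω))
    simp only [ContinuousLinearMap.comp_apply, ContinuousLinearMap.apply_apply] at h2
    rw [Finset.sum_congr rfl fun j _ => hj j, Finset.sum_add_distrib, Finset.sum_sub_distrib,
      ← Finset.mul_sum, hω1, ← Finset.mul_sum, ← Finset.mul_sum, ← h2, Finset.sum_sub_distrib]
    simp
    ring
  rw [Finset.sum_congr rfl fun i _ => key i, Finset.sum_add_distrib, Finset.sum_sub_distrib,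
    ← Finset.mul_sum, ← hL, ← hL]
  ring

end RotationInvariant

section ParametricIntegral

variable {H Y : Type*} [NormedAddCommGroup H] [NormedSpace ℝ H] [FiniteDimensional ℝ H]
  [NormedAddCommGroup Y] [NormedSpace ℝ Y] [FiniteDimensional ℝ Y] [MeasurableSpace Y]
  [BorelSpace Y] {μ : Measure Y} [IsFiniteMeasure μ] {K : Set Y}

theorem fderiv_integral_apply_of_ae_mem_compact (hK : IsCompact K) (hμ : ∀ᵐ y ∂μ, y ∈ K)
    {F : H × Y → ℝ} (hF : ContDiff ℝ 1 F) (z w : H) :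
    fderiv ℝ (fun z => ∫ y, F (z, y) ∂μ) z w = ∫ y, fderiv ℝ F (z, y) (w, 0) ∂μ := by
  rw [(hasFDerivAt_integral_of_ae_mem_compact hK hμ hF z).fderiv,
    ContinuousLinearMap.integral_apply]
  · rfl
  · exact integrable_of_ae_mem_compact hK hμ
      (((hF.continuous_fderiv one_ne_zero).comp (by fun_prop)).clm_comp continuous_const)

end ParametricIntegral

theorem fderiv_fderiv_apply {E G : Type*} [NormedAddCommGroup E] [NormedSpace ℝ E]
    [NormedAddCommGroup G] [NormedSpace ℝ G] {v : E → G} (hv : ContDiff ℝ 2 v) (z w w' : E) :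
    fderiv ℝ (fun z => fderiv ℝ v z w) z w' = fderiv ℝ (fderiv ℝ v) z w' w := by
  have hD : ContDiff ℝ 1 (fderiv ℝ v) := hv.fderiv_right (by norm_num)
  have := ((hD.differentiable one_ne_zero z).hasFDerivAt).clm_apply (hasFDerivAt_const w z)
  rw [this.fderiv]
  simp

section Darboux

variable {n : ℕ} {σ : Measure (EuclideanSpace ℝ (Fin n))} [IsFiniteMeasure σ]

local notation "𝔼" n => EuclideanSpace ℝ (Fin n)

theorem hasFDerivAt_add_smul {E : Type*} [NormedAddCommGroup E] [NormedSpace ℝ E]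
    (z : E × ℝ) (ω : E) :
    HasFDerivAt (fun q : (E × ℝ) × E => q.1.1 + q.1.2 • q.2)
      ((ContinuousLinearMap.fst ℝ E ℝ).comp (ContinuousLinearMap.fst ℝ (E × ℝ) E) +
        (z.2 • ContinuousLinearMap.snd ℝ (E × ℝ) E +
          ((ContinuousLinearMap.snd ℝ E ℝ).comp
            (ContinuousLinearMap.fst ℝ (E × ℝ) E)).smulRight ω)) (z, ω) := by
  have h2 : HasFDerivAt (fun q : (E × ℝ) × E => q.1.2) ((ContinuousLinearMap.snd ℝ E ℝ).comp
      (ContinuousLinearMap.fst ℝ (E × ℝ) E)) (z, ω) := hasFDerivAt_fst.snd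
  have h3 : HasFDerivAt (fun q : (E × ℝ) × E => q.2) (ContinuousLinearMap.snd ℝ (E × ℝ) E)
    (z, ω) := hasFDerivAt_snd
  have h4 : HasFDerivAt (fun q : (E × ℝ) × E => q.1.1) ((ContinuousLinearMap.fst ℝ E ℝ).comp
      (ContinuousLinearMap.fst ℝ (E × ℝ) E)) (z, ω) := hasFDerivAt_fst.fst
  exact h4.add (h2.smul h3)

theorem contDiff_integral_add_smul (hσ : ∀ᵐ ω ∂σ, ω ∈ Metric.sphere (0 : 𝔼 n) 1)
    {f : (𝔼 n) → ℝ} (hf : ContDiff ℝ 2 f) :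
    ContDiff ℝ 2 fun z : (𝔼 n) × ℝ => ∫ ω, f (z.1 + z.2 • ω) ∂σ :=
  contDiff_two_integral_of_ae_mem_compact (isCompact_sphere _ _) hσ
    (F := fun q : ((𝔼 n) × ℝ) × (𝔼 n) => f (q.1.1 + q.1.2 • q.2)) (hf.comp (by fun_prop))

theorem fderiv_integral_add_smul (hσ : ∀ᵐ ω ∂σ, ω ∈ Metric.sphere (0 : 𝔼 n) 1)
    {f : (𝔼 n) → ℝ} (hf : ContDiff ℝ 2 f) (z w : (𝔼 n) × ℝ) :
    fderiv ℝ (fun z : (𝔼 n) × ℝ => ∫ ω, f (z.1 + z.2 • ω) ∂σ) z w =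
      ∫ ω, fderiv ℝ f (z.1 + z.2 • ω) (w.1 + w.2 • ω) ∂σ := by
  rw [fderiv_integral_apply_of_ae_mem_compact (isCompact_sphere _ _) hσ
    (F := fun q : ((𝔼 n) × ℝ) × (𝔼 n) => f (q.1.1 + q.1.2 • q.2))
    ((hf.of_le (by norm_num)).comp (by fun_prop))]
  refine integral_congr_ae (.of_forall fun ω => ?_)
  have h1 := hasFDerivAt_add_smul z ω
  have h2 := (hf.differentiable two_ne_zero (z.1 + z.2 • ω)).hasFDerivAt.comp (z, ω) h1
  change fderiv ℝ (f ∘ fun q : ((𝔼 n) × ℝ) × (𝔼 n) => q.1.1 + q.1.2 • q.2) (z, ω) (w, 0) = _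
  rw [h2.fderiv]
  simp

theorem fderiv_fderiv_integral_add_smul (hσ : ∀ᵐ ω ∂σ, ω ∈ Metric.sphere (0 : 𝔼 n) 1)
    {f : (𝔼 n) → ℝ} (hf : ContDiff ℝ 2 f) (z w w' : (𝔼 n) × ℝ) :
    fderiv ℝ (fderiv ℝ fun z : (𝔼 n) × ℝ => ∫ ω, f (z.1 + z.2 • ω) ∂σ) z w' w =
      ∫ ω, fderiv ℝ (fderiv ℝ f) (z.1 + z.2 • ω) (w'.1 + w'.2 • ω) (w.1 + w.2 • ω) ∂σ := by
  have hD : ContDiff ℝ 1 (fderiv ℝ f) := hf.fderiv_right (by norm_num)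
  rw [← fderiv_fderiv_apply (contDiff_integral_add_smul hσ hf),
    funext fun z => fderiv_integral_add_smul hσ hf z w,
    fderiv_integral_apply_of_ae_mem_compact (isCompact_sphere _ _) hσ
    (F := fun q : ((𝔼 n) × ℝ) × (𝔼 n) => fderiv ℝ f (q.1.1 + q.1.2 • q.2) (w.1 + w.2 • q.2))
    ((hD.comp (by fun_prop)).clm_apply (by fun_prop))]
  refine integral_congr_ae (.of_forall fun ω => ?_)
  have h1 := hasFDerivAt_add_smul z ω
  have h2 : HasFDerivAt (fun q : ((𝔼 n) × ℝ) × (𝔼 n) => fderiv ℝ f (q.1.1 + q.1.2 • q.2)) _ (z, ω) :=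
    (hD.differentiable one_ne_zero (z.1 + z.2 • ω)).hasFDerivAt.comp (z, ω) h1
  have h3 : HasFDerivAt (fun q : ((𝔼 n) × ℝ) × (𝔼 n) => w.1 + w.2 • q.2) _ (z, ω) :=
    ((hasFDerivAt_snd : HasFDerivAt (fun q : ((𝔼 n) × ℝ) × (𝔼 n) => q.2)
      (ContinuousLinearMap.snd ℝ ((𝔼 n) × ℝ) (𝔼 n)) (z, ω)).const_smul w.2).const_add w.1
  have h4 := h2.clm_apply h3
  simp only
  rw [h4.fderiv]
  simp
  ring

theorem darboux_integral_add_smul (hσ : ∀ᵐ ω ∂σ, ω ∈ Metric.sphere (0 : 𝔼 n) 1)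
    (hrot : ∀ U : (𝔼 n) ≃ₗᵢ[ℝ] (𝔼 n), MeasurePreserving U σ σ)
    {f : (𝔼 n) → ℝ} (hf : ContDiff ℝ 2 f) {v : (𝔼 n) × ℝ → ℝ}
    (hv : v = fun z => ∫ ω, f (z.1 + z.2 • ω) ∂σ) (x : 𝔼 n) {t : ℝ} (ht : t ≠ 0) :
    t * ∑ i, fderiv ℝ (fderiv ℝ v) (x, t) (EuclideanSpace.single i 1, 0)
        (EuclideanSpace.single i 1, 0) =
      t * fderiv ℝ (fderiv ℝ v) (x, t) (0, 1) (0, 1) + ((n : ℝ) - 1) * fderiv ℝ v (x, t) (0, 1) := by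
  have hD : ContDiff ℝ 1 (fderiv ℝ f) := hf.fderiv_right (by norm_num)
  have hcont : ∀ y y' : 𝔼 n, ∀ c c' : ℝ, Integrable (fun ω =>
      fderiv ℝ (fderiv ℝ f) (x + t • ω) (y + c • ω) (y' + c' • ω)) σ := fun y y' c c' =>
    integrable_of_ae_mem_compact (isCompact_sphere _ _) hσ
      ((((hD.continuous_fderiv one_ne_zero).comp (by fun_prop)).clm_apply (by fun_prop)).clm_apply
        (by fun_prop))
  have hcont1 : Integrable (fun ω => fderiv ℝ f (x + t • ω) ω) σ :=
    integrable_of_ae_mem_compact (isCompact_sphere _ _) hσ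
      ((hD.continuous.comp (by fun_prop)).clm_apply continuous_id)
  have hh : ContDiff ℝ 2 fun y => f (x + t • y) := hf.comp (by fun_prop)
  have h1 : ∀ ω w, fderiv ℝ (fun y => f (x + t • y)) ω w = t * fderiv ℝ f (x + t • ω) w := by
    intro ω w
    have := (hf.differentiable two_ne_zero (x + t • ω)).hasFDerivAt.comp ω
      (((hasFDerivAt_id ω).const_smul t).const_add x)
    rw [show fderiv ℝ (fun y => f (x + t • y)) ω = _ from this.fderiv]
    simp
  have h2 : ∀ ω w w', fderiv ℝ (fderiv ℝ (fun y => f (x + t • y))) ω w' w =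
      t ^ 2 * fderiv ℝ (fderiv ℝ f) (x + t • ω) w' w := by
    intro ω w w'
    rw [← fderiv_fderiv_apply hh, funext fun ω => h1 ω w]
    have h3 : HasFDerivAt (fun ω => fderiv ℝ f (x + t • ω)) _ ω :=
      (hD.differentiable one_ne_zero (x + t • ω)).hasFDerivAt.comp ω
      (((hasFDerivAt_id ω).const_smul t).const_add x)
    rw [((h3.clm_apply (hasFDerivAt_const w ω)).const_mul t).fderiv]
    simp
    ring
  have key := integral_laplacian_sub_radial_eq_zero hσ hrot hh
  simp only [h1, h2] at key
  subst hv
  simp only [fderiv_fderiv_integral_add_smul hσ hf, fderiv_integral_add_smul hσ hf]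
  simp only [zero_smul, add_zero, one_smul, zero_add]
  have i1 := fun i : Fin n => hcont (EuclideanSpace.single i 1) (EuclideanSpace.single i 1) 0 0
  have i2 := hcont 0 0 1 1
  simp only [zero_smul, add_zero, one_smul, zero_add] at i1 i2
  rw [integral_sub, integral_sub, integral_finsetSum _ fun i _ => (i1 i).const_mul _] at key
  · simp only [integral_const_mul] at key
    rw [← Finset.mul_sum] at key
    apply mul_left_cancel₀ ht
    linear_combination key
  · exact integrable_finsetSum _ fun i _ => (i1 i).const_mul _
  · exact i2.const_mul _
  · exact (integrable_finsetSum _ fun i _ => (i1 i).const_mul _).sub (i2.const_mul _)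
  · exact (hcont1.const_mul _).const_mul _

end Darboux

section SphericalMean

local notation "𝔼" n => EuclideanSpace ℝ (Fin n)

theorem setIntegral_sphere_hausdorffMeasure {n : ℕ} (hn : 1 ≤ n) (f : (𝔼 n) → ℝ) (x : 𝔼 n)
    {t : ℝ} (ht : 0 < t) :
    ∫ y in Metric.sphere x t, f y ∂(μH[(n : ℝ) - 1]) =
      t ^ (n - 1) * ∫ ω in Metric.sphere (0 : 𝔼 n) 1, f (x + t • ω) ∂(μH[(n : ℝ) - 1]) := by
  have hd : (0 : ℝ) ≤ (n : ℝ) - 1 := sub_nonneg.2 (by exact_mod_cast hn)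
  let φ : (𝔼 n) ≃ₜ (𝔼 n) := (Homeomorph.smulOfNeZero t ht.ne').trans (Homeomorph.addLeft x)
  have hφ : ∀ ω, φ ω = x + t • ω := fun ω => rfl
  have hmap : Measure.map φ (μH[(n : ℝ) - 1]) =
      (‖t‖₊⁻¹ ^ ((n : ℝ) - 1)) • (μH[(n : ℝ) - 1] : Measure (𝔼 n)) := by
    have h1 := (IsometryEquiv.addLeft x).map_hausdorffMeasure ((n : ℝ) - 1)
    rw [← map_homothety_hausdorffMeasure hd x ht.ne']
    conv_rhs => rw [← h1]
    rw [Measure.map_map]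
    · congr 1
      ext1 ω
      simp [hφ, AffineMap.homothety_apply, add_comm]
    · exact (AffineMap.homothety_continuous x t).measurable
    · exact (IsometryEquiv.addLeft x).continuous.measurable
  have hpre : φ ⁻¹' Metric.sphere x t = Metric.sphere 0 1 := by
    ext ω
    simp [hφ, norm_smul, abs_of_pos ht, ht.ne']
  have h2 := φ.measurableEmbedding.setIntegral_map (μ := μH[(n : ℝ) - 1]) f (Metric.sphere x t)
  rw [hmap, hpre, Measure.restrict_smul, integral_smul_nnreal_measure] at h2
  simp only [hφ] at h2
  rw [← h2, NNReal.smul_def, smul_eq_mul, ← mul_assoc]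
  have h3 : t ^ (n - 1) * ((‖t‖₊⁻¹ ^ ((n : ℝ) - 1) : NNReal) : ℝ) = 1 := by
    have h4 : (n : ℝ) - 1 = ((n - 1 : ℕ) : ℝ) := by push_cast [hn]; ring
    rw [h4, NNReal.rpow_natCast]
    push_cast
    rw [Real.norm_of_nonneg ht.le, ← mul_pow, mul_inv_cancel₀ ht.ne', one_pow]
  rw [h3, one_mul]

theorem measurePreserving_linearIsometryEquiv_sphere {n : ℕ} (d : ℝ) (U : (𝔼 n) ≃ₗᵢ[ℝ] (𝔼 n)) :
    MeasurePreserving U (μH[d].restrict (Metric.sphere (0 : 𝔼 n) 1))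
      (μH[d].restrict (Metric.sphere (0 : 𝔼 n) 1)) := by
  have h := (U.toIsometryEquiv.measurePreserving_hausdorffMeasure d).restrict_preimage
    (Metric.isClosed_sphere (x := (0 : 𝔼 n)) (ε := 1)).measurableSet
  have hpre : U.toIsometryEquiv ⁻¹' Metric.sphere (0 : 𝔼 n) 1 = Metric.sphere 0 1 := by
    ext ω
    simp
  rwa [hpre] at h

end SphericalMean

section Indicator

variable {E : Type*} [NormedAddCommGroup E] [NormedSpace ℝ E] {A : Set E} {h : E → ℝ}

theorem hasFDerivAt_indicator_of_frontier (hh : Differentiable ℝ h)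
    (h0 : ∀ z ∈ frontier A, h z = 0) (h1 : ∀ z ∈ frontier A, fderiv ℝ h z = 0) (z : E) :
    HasFDerivAt (A.indicator h) (A.indicator (fderiv ℝ h) z) z := by
  by_cases hz : z ∈ frontier A
  · have hd := (hh z).hasFDerivAt
    rw [h1 z hz, hasFDerivAt_iff_isLittleO] at hd
    have e1 : A.indicator (fderiv ℝ h) z = 0 := by simp [h1 z hz]
    have e2 : A.indicator h z = 0 := by simp [h0 z hz]
    rw [e1, hasFDerivAt_iff_isLittleO]
    refine (Asymptotics.isBigO_of_le _ fun y => ?_).trans_isLittleO hd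
    by_cases hy : y ∈ A <;> simp [hy, e2, h0 z hz]
  · by_cases hzA : z ∈ A
    · have hn : A ∈ nhds z := by
        rw [← mem_interior_iff_mem_nhds]
        by_contra hc
        exact hz ⟨subset_closure hzA, hc⟩
      rw [Set.indicator_of_mem hzA]
      refine (hh z).hasFDerivAt.congr_of_eventuallyEq ?_
      filter_upwards [hn] with y hy using Set.indicator_of_mem hy h
    · have hn : Aᶜ ∈ nhds z := by
        rw [← mem_interior_iff_mem_nhds, interior_compl]
        exact fun hc => hz ⟨hc, fun hi => hzA (interior_subset hi)⟩
      rw [Set.indicator_of_notMem hzA]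
      refine (hasFDerivAt_const (0 : ℝ) z).congr_of_eventuallyEq ?_
      filter_upwards [hn] with y hy using Set.indicator_of_notMem hy h

theorem contDiff_indicator_of_frontier (hh : ContDiff ℝ 1 h)
    (h0 : ∀ z ∈ frontier A, h z = 0) (h1 : ∀ z ∈ frontier A, fderiv ℝ h z = 0) :
    ContDiff ℝ 1 (A.indicator h) := by
  rw [contDiff_one_iff_hasFDerivAt]
  exact ⟨_, (hh.continuous_fderiv one_ne_zero).indicator h1,
    hasFDerivAt_indicator_of_frontier (hh.differentiable one_ne_zero) h0 h1⟩

end Indicator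

theorem integral_fderiv_apply_eq_zero_of_hasCompactSupport {E : Type*} [NormedAddCommGroup E]
    [NormedSpace ℝ E] [FiniteDimensional ℝ E] [MeasurableSpace E] [BorelSpace E]
    (μ : Measure E) [μ.IsAddHaarMeasure] {g : E → ℝ} (hg : ContDiff ℝ 1 g)
    (hc : HasCompactSupport g) (e : E) : ∫ x, fderiv ℝ g x e ∂μ = 0 := by
  have hi : Integrable (fun x => fderiv ℝ g x e) μ :=
    ((hg.continuous_fderiv one_ne_zero).clm_apply continuous_const).integrable_of_hasCompactSupport
      (hc.fderiv_apply ℝ e)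
  have := integral_mul_fderiv_eq_neg_fderiv_mul_of_integrable (μ := μ) (f := fun _ => (1 : ℝ))
    (g := g) (v := e) (by simp) (by simpa using hi)
    (by simpa using hg.continuous.integrable_of_hasCompactSupport hc)
    (fun x _ => differentiableAt_const _) (fun x _ => hg.differentiable one_ne_zero x)
  simpa using this

section Energy

variable {n : ℕ}

local notation "𝔼" n => EuclideanSpace ℝ (Fin n)

/-- A smooth weight on space-time, positive exactly inside the light cones with vertex `(p, T)`. -/
noncomputable def coneWeight (p : 𝔼 n) (T : ℝ) (z : (𝔼 n) × ℝ) : ℝ :=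
  expNegInvGlue ((T - z.2) ^ 2 - ‖z.1 - p‖ ^ 2)

theorem contDiff_coneWeight (p : 𝔼 n) (T : ℝ) : ContDiff ℝ 1 (coneWeight p T) := by
  refine (expNegInvGlue.contDiff (n := 1)).comp ?_
  exact ((contDiff_const.sub contDiff_snd).pow 2).sub ((contDiff_fst.sub contDiff_const).norm_sq ℝ)

theorem fderiv_coneWeight (p : 𝔼 n) (T : ℝ) (z w : (𝔼 n) × ℝ) :
    fderiv ℝ (coneWeight p T) z w =
      deriv expNegInvGlue ((T - z.2) ^ 2 - ‖z.1 - p‖ ^ 2) *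
        (-(2 * (T - z.2) * w.2) - 2 * inner ℝ (z.1 - p) w.1) := by
  have h1 : HasFDerivAt (fun z : (𝔼 n) × ℝ => z.1 - p) (ContinuousLinearMap.fst ℝ (𝔼 n) ℝ) z :=
    hasFDerivAt_fst.sub_const p
  have h2 : HasFDerivAt (fun z : (𝔼 n) × ℝ => T - z.2) (-ContinuousLinearMap.snd ℝ (𝔼 n) ℝ) z :=
    hasFDerivAt_snd.const_sub T
  have h3 := (HasFDerivAt.pow h2 2).fun_sub h1.norm_sq
  have h4 : HasDerivAt expNegInvGlue (deriv expNegInvGlue ((T - z.2) ^ 2 - ‖z.1 - p‖ ^ 2))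
      ((T - z.2) ^ 2 - ‖z.1 - p‖ ^ 2) :=
    ((expNegInvGlue.contDiff (n := 1)).differentiable (by simp) _).hasDerivAt
  have h5 : HasFDerivAt (coneWeight p T) _ z := h4.comp_hasFDerivAt z h3
  rw [h5.fderiv]
  simp [inner_sub_left]

theorem deriv_expNegInvGlue_of_neg {r : ℝ} (hr : r < 0) : deriv expNegInvGlue r = 0 := by
  have : expNegInvGlue =ᶠ[nhds r] fun _ => 0 := by
    filter_upwards [gt_mem_nhds hr] with x hx using expNegInvGlue.zero_of_nonpos hx.le
  rw [this.deriv_eq, deriv_const]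

theorem coneWeight_energy_flux_nonneg (p : 𝔼 n) (T : ℝ) (z : (𝔼 n) × ℝ) (hz : z.2 ≤ T)
    (a : ℝ) (b : Fin n → ℝ) :
    fderiv ℝ (coneWeight p T) z (0, 1) * ((a ^ 2 + ∑ i, b i ^ 2) / 2) ≤
      ∑ i, fderiv ℝ (coneWeight p T) z (EuclideanSpace.single i 1, 0) * (a * b i) := by
  simp only [fderiv_coneWeight, inner_zero_right, EuclideanSpace.inner_single_right]
  rcases lt_or_ge ((T - z.2) ^ 2 - ‖z.1 - p‖ ^ 2) 0 with h | h
  · simp [deriv_expNegInvGlue_of_neg h]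
  have hφ : 0 ≤ deriv expNegInvGlue ((T - z.2) ^ 2 - ‖z.1 - p‖ ^ 2) :=
    expNegInvGlue.monotone.deriv_nonneg
  set φ := deriv expNegInvGlue ((T - z.2) ^ 2 - ‖z.1 - p‖ ^ 2)
  set y := z.1 - p
  have hτ : 0 ≤ T - z.2 := sub_nonneg.2 hz
  set τ := T - z.2
  have hcs := Finset.sum_mul_sq_le_sq_mul_sq Finset.univ (fun i => y i) b
  rw [← EuclideanSpace.real_norm_sq_eq] at hcs
  have hB : 0 ≤ ∑ i, b i ^ 2 := Finset.sum_nonneg fun i _ => sq_nonneg _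
  set B := ∑ i, b i ^ 2
  set S := ∑ i, y i * b i with hS
  have hS2 : (a * S) ^ 2 ≤ (τ * ((a ^ 2 + B) / 2)) ^ 2 := by
    have e1 : S ^ 2 ≤ τ ^ 2 * B := hcs.trans (mul_le_mul_of_nonneg_right (by linarith) hB)
    have e2 : a ^ 2 * S ^ 2 ≤ a ^ 2 * (τ ^ 2 * B) := mul_le_mul_of_nonneg_left e1 (sq_nonneg a)
    nlinarith [mul_nonneg (sq_nonneg τ) (sq_nonneg (a ^ 2 - B))]
  have hS3 : a * S ≤ τ * ((a ^ 2 + B) / 2) := (le_abs_self _).trans (abs_le_of_sq_le_sq hS2 (by positivity))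
  have hsum : ∑ i, φ * (-(2 * τ * 0) - 2 * (1 * (starRingEnd ℝ) (y i))) * (a * b i) =
      φ * (-2 * (a * S)) := by
    rw [hS, Finset.mul_sum, Finset.mul_sum, Finset.mul_sum]
    refine Finset.sum_congr rfl fun i _ => ?_
    simp
    ring
  rw [hsum]
  nlinarith [mul_le_mul_of_nonneg_left hS3 hφ]

/-- **Domain of dependence** for the Euler-Poisson-Darboux equation: a solution whose Cauchy data
vanish on the graph of a positive continuous function vanishes above this graph. -/
theorem eq_zero_above_graph_of_darboux {v : (𝔼 n) × ℝ → ℝ} (hv : ContDiff ℝ 2 v) {c : ℝ}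
    (hc : 0 ≤ c)
    (hpde : ∀ x t, 0 < t → t * ∑ i, fderiv ℝ (fderiv ℝ v) (x, t) (EuclideanSpace.single i 1, 0)
        (EuclideanSpace.single i 1, 0) =
      t * fderiv ℝ (fderiv ℝ v) (x, t) (0, 1) (0, 1) + c * fderiv ℝ v (x, t) (0, 1))
    {u : (𝔼 n) → ℝ} (hu : Continuous u) (hupos : ∀ x, 0 < u x)
    (h0 : ∀ x, v (x, u x) = 0) (h1 : ∀ x, fderiv ℝ v (x, u x) = 0)
    (p : 𝔼 n) {T : ℝ} (hT : u p ≤ T) : v (p, T) = 0 := by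
  have hT0 : 0 < T := (hupos p).trans_le hT
  let e : Fin n → (𝔼 n) × ℝ := fun i => (EuclideanSpace.single i 1, 0)
  let A : Set ((𝔼 n) × ℝ) := {z | u z.1 ≤ z.2}
  have hA : IsClosed A := isClosed_le (hu.comp continuous_fst) continuous_snd
  have hfr : ∀ z ∈ frontier A, u z.1 = z.2 := fun z hz =>
    frontier_le_subset_eq (hu.comp continuous_fst) continuous_snd hz
  let ψ := coneWeight p T
  have hψ : ContDiff ℝ 1 ψ := contDiff_coneWeight p T
  let a : (𝔼 n) × ℝ → ℝ := fun z => fderiv ℝ v z (0, 1)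
  let b : Fin n → (𝔼 n) × ℝ → ℝ := fun i z => fderiv ℝ v z (e i)
  have hD : ContDiff ℝ 1 (fderiv ℝ v) := hv.fderiv_right (by norm_num)
  have ha : ContDiff ℝ 1 a := hD.clm_apply contDiff_const
  have hb : ∀ i, ContDiff ℝ 1 (b i) := fun i => hD.clm_apply contDiff_const
  have ha' : ∀ z w, fderiv ℝ a z w = fderiv ℝ (fderiv ℝ v) z w (0, 1) := fun z w =>
    fderiv_fderiv_apply hv z (0, 1) w
  have hb' : ∀ i z w, fderiv ℝ (b i) z w = fderiv ℝ (fderiv ℝ v) z w (e i) := fun i z w =>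
    fderiv_fderiv_apply hv z (e i) w
  have hsymm : ∀ z w w', fderiv ℝ (fderiv ℝ v) z w w' = fderiv ℝ (fderiv ℝ v) z w' w :=
    fun z w w' => (hv.contDiffAt.isSymmSndFDerivAt (by simp)) w w'
  let en : (𝔼 n) × ℝ → ℝ := fun z => (a z ^ 2 + ∑ i, b i z ^ 2) / 2
  have hen : ContDiff ℝ 1 en :=
    ((ha.pow 2).add (ContDiff.sum fun i _ => (hb i).pow 2)).div_const 2
  have hdiff : ∀ {g : (𝔼 n) × ℝ → ℝ}, ContDiff ℝ 1 g → ∀ z, HasFDerivAt g (fderiv ℝ g z) z :=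
    fun hg z => (hg.differentiable one_ne_zero z).hasFDerivAt
  have hen' : ∀ z w, fderiv ℝ en z w = a z * fderiv ℝ a z w + ∑ i, b i z * fderiv ℝ (b i) z w := by
    intro z w
    have h2 := ((HasFDerivAt.pow (hdiff ha z) 2).fun_add
      (HasFDerivAt.fun_sum fun i (_ : i ∈ Finset.univ) => HasFDerivAt.pow (hdiff (hb i) z) 2)).mul_const
      (2⁻¹ : ℝ)
    have h3 : HasFDerivAt en _ z := h2.congr_of_eventuallyEq (.of_forall fun z => div_eq_mul_inv _ _)
    rw [h3.fderiv]
    simp [Finset.mul_sum, mul_assoc]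
  let q : (𝔼 n) × ℝ → ℝ := fun z => ψ z * en z
  let r : Fin n → (𝔼 n) × ℝ → ℝ := fun i z => ψ z * (a z * b i z)
  have hq : ContDiff ℝ 1 q := hψ.mul hen
  have hr : ∀ i, ContDiff ℝ 1 (r i) := fun i => hψ.mul (ha.mul (hb i))
  have hq' : ∀ z w, fderiv ℝ q z w = ψ z * fderiv ℝ en z w + fderiv ℝ ψ z w * en z := by
    intro z w
    rw [show fderiv ℝ q z = _ from ((hdiff hψ z).mul (hdiff hen z)).fderiv]
    simp [mul_comm]
  have hr' : ∀ i z w, fderiv ℝ (r i) z w =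
      ψ z * (a z * fderiv ℝ (b i) z w + fderiv ℝ a z w * b i z)
        + fderiv ℝ ψ z w * (a z * b i z) := by
    intro i z w
    rw [show fderiv ℝ (r i) z = _ from
      ((hdiff hψ z).mul ((hdiff ha z).mul (hdiff (hb i) z))).fderiv]
    simp
    ring
  have hafr : ∀ z ∈ frontier A, a z = 0 := fun z hz => by
    have : fderiv ℝ v z = 0 := by simpa [hfr z hz] using h1 z.1
    simp [a, this]
  have hbfr : ∀ i, ∀ z ∈ frontier A, b i z = 0 := fun i z hz => by
    have : fderiv ℝ v z = 0 := by simpa [hfr z hz] using h1 z.1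
    simp [b, this]
  have henfr : ∀ z ∈ frontier A, en z = 0 := fun z hz => by
    simp [en, hafr z hz, hbfr _ z hz]
  have hqfr : ∀ z ∈ frontier A, q z = 0 := fun z hz => by simp [q, henfr z hz]
  have hqfr' : ∀ z ∈ frontier A, fderiv ℝ q z = 0 := fun z hz => by
    ext1 <;> ext1 <;> simp [hq', hen', henfr z hz, hafr z hz, hbfr _ z hz]
  have hrfr : ∀ i, ∀ z ∈ frontier A, r i z = 0 := fun i z hz => by simp [r, hafr z hz]
  have hrfr' : ∀ i, ∀ z ∈ frontier A, fderiv ℝ (r i) z = 0 := fun i z hz => by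
    ext1 <;> ext1 <;> simp [hr', hafr z hz, hbfr _ z hz]
  have hQ : ContDiff ℝ 1 (A.indicator q) := contDiff_indicator_of_frontier hq hqfr hqfr'
  have hR : ∀ i, ContDiff ℝ 1 (A.indicator (r i)) := fun i =>
    contDiff_indicator_of_frontier (hr i) (hrfr i) (hrfr' i)
  have hQ' : ∀ z, fderiv ℝ (A.indicator q) z = A.indicator (fderiv ℝ q) z := fun z =>
    (hasFDerivAt_indicator_of_frontier (hq.differentiable one_ne_zero) hqfr hqfr' z).fderiv
  have hR' : ∀ i z, fderiv ℝ (A.indicator (r i)) z = A.indicator (fderiv ℝ (r i)) z := fun i z =>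
    (hasFDerivAt_indicator_of_frontier ((hr i).differentiable one_ne_zero)
      (hrfr i) (hrfr' i) z).fderiv
  have hψ0 : ∀ z, 0 ≤ ψ z := fun z => expNegInvGlue.nonneg _
  have hen0 : ∀ z, 0 ≤ en z := fun z =>
    div_nonneg (add_nonneg (sq_nonneg _) (Finset.sum_nonneg fun i _ => sq_nonneg _)) zero_le_two
  have hQ0 : ∀ z, 0 ≤ A.indicator q z := fun z =>
    Set.indicator_nonneg (fun z _ => mul_nonneg (hψ0 z) (hen0 z)) z
  have hdis : ∀ z, z.2 ≤ T →
      fderiv ℝ (A.indicator q) z (0, 1) ≤ ∑ i, fderiv ℝ (A.indicator (r i)) z (e i) := by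
    intro z hzT
    by_cases hz : z ∈ A
    · have hz0 : 0 < z.2 := (hupos z.1).trans_le hz
      simp only [hQ', hR', Set.indicator_of_mem hz, hq', hr', hen', ha', hb',
        Finset.sum_add_distrib, ← Finset.mul_sum]
      have hflux := coneWeight_energy_flux_nonneg p T z hzT (a z) fun i => b i z
      have hp := hpde z.1 z.2 hz0
      change z.2 * ∑ i, fderiv ℝ (fderiv ℝ v) z (e i) (e i) =
        z.2 * fderiv ℝ (fderiv ℝ v) z (0, 1) (0, 1) + c * a z at hp
      have hp' : ∑ i, fderiv ℝ (fderiv ℝ v) z (e i) (e i) =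
          fderiv ℝ (fderiv ℝ v) z (0, 1) (0, 1) + c / z.2 * a z := by
        field_simp
        linarith
      have hcross : ∑ i, b i z * fderiv ℝ (fderiv ℝ v) z (0, 1) (e i) =
          ∑ i, fderiv ℝ (fderiv ℝ v) z (e i) (0, 1) * b i z :=
        Finset.sum_congr rfl fun i _ => by rw [hsymm, mul_comm]
      rw [hp', hcross]
      have hpos : 0 ≤ ψ z * (c / z.2 * a z ^ 2) :=
        mul_nonneg (hψ0 z) (mul_nonneg (div_nonneg hc hz0.le) (sq_nonneg _))
      have hflux' : fderiv ℝ ψ z (0, 1) * en z ≤ ∑ i, fderiv ℝ ψ z (e i) * (a z * b i z) := hflux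
      linear_combination hflux' + hpos
    · simp [hQ', hR', Set.indicator_of_notMem hz]
  let μ : Measure (𝔼 n) := volume.restrict (Metric.closedBall p T)
  have hμ : ∀ᵐ x ∂μ, x ∈ Metric.closedBall p T :=
    ae_restrict_mem Metric.isClosed_closedBall.measurableSet
  have : IsFiniteMeasure μ := ⟨by
    simpa [μ] using (isCompact_closedBall p T).measure_lt_top⟩
  let F : ℝ × (𝔼 n) → ℝ := fun y => A.indicator q (y.2, y.1)
  have hF : ContDiff ℝ 1 F := hQ.comp (contDiff_snd.prodMk contDiff_fst)
  have hF' : ∀ s x, fderiv ℝ F (s, x) (1, 0) = fderiv ℝ (A.indicator q) (x, s) (0, 1) := by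
    intro s x
    have h2 : HasFDerivAt (fun y : ℝ × (𝔼 n) => (y.2, y.1))
        ((ContinuousLinearMap.snd ℝ ℝ (𝔼 n)).prod (ContinuousLinearMap.fst ℝ ℝ (𝔼 n))) (s, x) :=
      hasFDerivAt_snd.prodMk hasFDerivAt_fst
    have h3 : HasFDerivAt F _ (s, x) := HasFDerivAt.comp (g := A.indicator q) (s, x)
      (hdiff hQ (x, s)) h2
    rw [h3.fderiv]
    simp
  let En : ℝ → ℝ := fun s => ∫ x, F (s, x) ∂μ
  have hEn : ContDiff ℝ 1 En :=
    contDiff_one_integral_of_ae_mem_compact (isCompact_closedBall p T) hμ hF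
  have hRint : ∀ i s, 0 ≤ s → s ≤ T → ∫ x, fderiv ℝ (A.indicator (r i)) (x, s) (e i) ∂μ = 0 := by
    intro i s hs0 hsT
    let g : (𝔼 n) → ℝ := fun x => A.indicator (r i) (x, s)
    have hg : ContDiff ℝ 1 g := (hR i).comp (contDiff_id.prodMk contDiff_const)
    have hg' : ∀ x, fderiv ℝ g x (EuclideanSpace.single i 1) =
        fderiv ℝ (A.indicator (r i)) (x, s) (e i) := by
      intro x
      have h3 : HasFDerivAt g _ x := HasFDerivAt.comp (g := A.indicator (r i)) x
        (hdiff (hR i) (x, s)) (hasFDerivAt_prodMk_left x s)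
      rw [h3.fderiv]
      simp [e]
    have hg0 : ∀ x ∉ Metric.closedBall p T, g x = 0 := by
      intro x hx
      have hx' : T < ‖x - p‖ := by simpa [dist_eq_norm] using hx
      have : ψ (x, s) = 0 := expNegInvGlue.zero_of_nonpos (by
        show (T - s) ^ 2 - ‖x - p‖ ^ 2 ≤ 0
        nlinarith)
      by_cases hxA : (x, s) ∈ A <;> simp [g, r, hxA, this]
    have hgc : HasCompactSupport g := HasCompactSupport.intro (isCompact_closedBall p T) hg0
    have hts : tsupport g ⊆ Metric.closedBall p T :=
      closure_minimal (fun x hx => by_contra fun h => hx (hg0 x h)) Metric.isClosed_closedBall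
    rw [← integral_fderiv_apply_eq_zero_of_hasCompactSupport volume hg hgc
      (EuclideanSpace.single i 1)]
    simp only [hg']
    refine setIntegral_eq_integral_of_forall_compl_eq_zero fun x hx => ?_
    rw [← hg', image_eq_zero_of_notMem_tsupport fun h => hx (hts (tsupport_fderiv_subset ℝ h))]
    rfl
  have hEn' : ∀ s, 0 ≤ s → s ≤ T → deriv En s ≤ 0 := by
    intro s hs0 hsT
    have h2 := fderiv_integral_apply_of_ae_mem_compact (isCompact_closedBall p T) hμ hF s 1
    rw [← fderiv_apply_one_eq_deriv, show fderiv ℝ En s 1 = _ from h2]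
    simp only [hF']
    have hi : ∀ i, Integrable (fun x => fderiv ℝ (A.indicator (r i)) (x, s) (e i)) μ := fun i =>
      integrable_of_ae_mem_compact (isCompact_closedBall p T) hμ
        ((((hR i).continuous_fderiv one_ne_zero).comp (by fun_prop)).clm_apply continuous_const)
    calc ∫ x, fderiv ℝ (A.indicator q) (x, s) (0, 1) ∂μ
        ≤ ∫ x, ∑ i, fderiv ℝ (A.indicator (r i)) (x, s) (e i) ∂μ := by
          refine integral_mono ?_ (integrable_finsetSum _ fun i _ => hi i) fun x => hdis (x, s) hsT
          exact integrable_of_ae_mem_compact (isCompact_closedBall p T) hμ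
            (((hQ.continuous_fderiv one_ne_zero).comp (by fun_prop)).clm_apply continuous_const)
      _ = 0 := by
          rw [integral_finsetSum _ fun i _ => hi i]
          exact Finset.sum_eq_zero fun i _ => hRint i s hs0 hsT
  have hanti : AntitoneOn En (Set.Icc 0 T) := by
    refine antitoneOn_of_deriv_nonpos (convex_Icc 0 T) hEn.continuous.continuousOn
      (hEn.differentiable one_ne_zero).differentiableOn fun s hs => ?_
    rw [interior_Icc] at hs
    exact hEn' s hs.1.le hs.2.le
  have hE0 : En 0 = 0 := by
    have : ∀ x, F (0, x) = 0 := fun x =>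
      Set.indicator_of_notMem (s := A) (a := (x, (0 : ℝ))) (fun h => (hupos x).not_ge h) q
    simp [En, this]
  have hFzero : ∀ s, 0 ≤ s → s ≤ T → F (s, p) = 0 := by
    intro s hs0 hsT
    have hFs : Continuous fun x => F (s, x) := hF.continuous.comp (by fun_prop)
    have hEs : En s = 0 := le_antisymm
      (hE0 ▸ hanti ⟨le_rfl, hT0.le⟩ ⟨hs0, hsT⟩ hs0) (integral_nonneg fun x => hQ0 _)
    have hae : (fun x => F (s, x)) =ᵐ[μ] 0 :=
      (integral_eq_zero_iff_of_nonneg (fun x => hQ0 _)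
        (integrable_of_ae_mem_compact (isCompact_closedBall p T) hμ hFs)).1 hEs
    have hae' : (fun x => F (s, x)) =ᵐ[volume.restrict (Metric.ball p T)] fun _ => 0 :=
      ae_restrict_of_ae_restrict_of_subset Metric.ball_subset_closedBall hae
    exact Measure.eqOn_open_of_ae_eq hae' Metric.isOpen_ball hFs.continuousOn
      continuousOn_const (Metric.mem_ball_self hT0)
  have hap : ∀ s, u p ≤ s → s < T → a (p, s) = 0 := by
    intro s hs hsT
    have h2 : A.indicator q (p, s) = 0 := hFzero s ((hupos p).le.trans hs) hsT.le
    rw [Set.indicator_of_mem (show (p, s) ∈ A from hs)] at h2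
    have hpos : 0 < ψ (p, s) := expNegInvGlue.pos_of_pos (by
      simpa using pow_pos (sub_pos.2 hsT) 2)
    have h3 : en (p, s) = 0 := (mul_eq_zero.1 h2).resolve_left hpos.ne'
    have h4 : 0 ≤ ∑ i, b i (p, s) ^ 2 := Finset.sum_nonneg fun i _ => sq_nonneg _
    have h5 : (a (p, s) ^ 2 + ∑ i, b i (p, s) ^ 2) / 2 = 0 := h3
    have h6 : a (p, s) ^ 2 = 0 := le_antisymm (by linarith) (sq_nonneg _)
    exact pow_eq_zero_iff two_ne_zero |>.1 h6
  have hder : ∀ s, HasDerivAt (fun s => v (p, s)) (a (p, s)) s := fun s =>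
    HasFDerivAt.comp_hasDerivAt (l := v) s (hv.differentiable two_ne_zero (p, s)).hasFDerivAt
      ((hasDerivAt_const s p).prodMk (hasDerivAt_id s))
  rw [← h0 p]
  refine constant_of_has_deriv_right_zero (f := fun s => v (p, s))
    (hv.continuous.comp (by fun_prop)).continuousOn (fun s hs => ?_) T ⟨hT, le_rfl⟩
  have := (hder s).hasDerivWithinAt (s := Set.Ici s)
  rwa [hap s hs.1 hs.2] at this

end Energy

/-- If the spherical mean transform `Rf` of a `C²` function `f` vanishes together with all its
first-order derivatives on a space like graph `S = {(x, u(x))}` (`u > 0`, `|∇u| ≤ 1`), then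
`Rf` vanishes at every point above `S`, i.e. `Rf(p, T) = 0` whenever `T ≥ u(p)`. -/
theorem stmt7 (n : ℕ) (hn : 2 ≤ n) (f : EuclideanSpace ℝ (Fin n) → ℝ)
    (hf : ContDiff ℝ 2 f) (u : EuclideanSpace ℝ (Fin n) → ℝ)
    (hu : ContDiff ℝ 1 u) (hupos : ∀ x, 0 < u x)
    (hgrad : ∀ x, ‖gradient u x‖ ≤ 1)
    (hvanish : ∀ x, sphericalMean n f (x, u x) = 0)
    (hvanish' : ∀ x, fderiv ℝ (sphericalMean n f) (x, u x) = 0) :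
    ∀ p : EuclideanSpace ℝ (Fin n), ∀ T : ℝ, u p ≤ T → sphericalMean n f (p, T) = 0 := by
  have hn1 : 1 ≤ n := one_le_two.trans hn
  let σ : Measure (EuclideanSpace ℝ (Fin n)) := (μH[(n : ℝ) - 1]).restrict (Metric.sphere 0 1)
  have : IsFiniteMeasure σ := ⟨by
    simpa [σ] using hausdorffMeasure_unitSphere_lt_top n hn1⟩
  have hσ : ∀ᵐ ω ∂σ, ω ∈ Metric.sphere (0 : EuclideanSpace ℝ (Fin n)) 1 :=
    ae_restrict_mem Metric.isClosed_sphere.measurableSet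
  let v : EuclideanSpace ℝ (Fin n) × ℝ → ℝ := fun z => ∫ ω, f (z.1 + z.2 • ω) ∂σ
  have hv : ContDiff ℝ 2 v := contDiff_integral_add_smul hσ hf
  have hmean : ∀ z : EuclideanSpace ℝ (Fin n) × ℝ, 0 < z.2 →
      sphericalMean n f z = z.2 ^ (n - 1) * v z :=
    fun z hz => setIntegral_sphere_hausdorffMeasure hn1 f z.1 hz
  have h0 : ∀ x, v (x, u x) = 0 := fun x =>
    (mul_eq_zero.1 ((hmean (x, u x) (hupos x)).symm.trans (hvanish x))).resolve_left
      (pow_pos (hupos x) _).ne'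
  have h1 : ∀ x, fderiv ℝ v (x, u x) = 0 := by
    intro x
    have hev : sphericalMean n f =ᶠ[nhds (x, u x)] fun z => z.2 ^ (n - 1) * v z := by
      filter_upwards [(isOpen_lt continuous_const continuous_snd).mem_nhds (hupos x)]
        with z hz using hmean z hz
    have hpow : HasFDerivAt (fun z : EuclideanSpace ℝ (Fin n) × ℝ => z.2 ^ (n - 1)) _ (x, u x) :=
      (hasFDerivAt_snd (𝕜 := ℝ)).pow (n - 1)
    have hprod := hpow.fun_mul (hv.differentiable two_ne_zero (x, u x)).hasFDerivAt
    have h := hvanish' x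
    rw [hev.fderiv_eq, hprod.fderiv, h0 x, zero_smul, add_zero] at h
    exact (smul_eq_zero.1 h).resolve_left (pow_pos (hupos x) _).ne'
  intro p T hT
  rw [hmean (p, T) ((hupos p).trans_le hT), eq_zero_above_graph_of_darboux hv
    (sub_nonneg.2 (by exact_mod_cast hn1 : (1 : ℝ) ≤ n))
    (fun x t ht => darboux_integral_add_smul hσ
      (measurePreserving_linearIsometryEquiv_sphere _) hf rfl x ht.ne')
    hu.continuous hupos h0 h1 p hT, mul_zero]
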